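/- arXiv:1205.1247 — 2 statements merged into one kernel-verified Lean document; each statement's English description precedes it below -/
import Mathlib

section
/- Let E = (E⁰, E¹, r, s) be a directed graph, H ⊆ E⁰ a saturated hereditary subset, S ⊆ B_H, K a field, A an associative K-algebra, and {P_v, S_e, S_e* : v ∈ E⁰, e ∈ E¹} a Leavitt E-family in A. For each vertex w of \overline{E}_{(H,S)} define Q_w := P_w if w ∈ H; Q_w := P_w^H if w ∈ S; Q_w := S_α S_α* if w = α ∈ F₁(H,S); Q_w := S_α P_{r(α)}^H S_α* if w = α ∈ F₂(H,S). For each edge f of \overline{E}_{(H,S)} define T_f := S_f and T_f^* := S_f* if f ∈ E¹; T_f := S_α and T_f^* := S_α* if f = ā with α ∈ F₁(H,S); T_f := S_α P_{r(α)}^H and T_f^* := P_{r(α)}^H S_α* if f = ā with α ∈ F₂(H,S). Then {Q_w, T_f, T_f^*} is a Leavitt \overline{E}_{(H,S)}-family in A: the Q_w are pairwise orthogonal idempotents; Q_{s(f)} T_f = T_f = T_f Q_{r(f)} and Q_{r(f)} T_f^* = T_f^* = T_f^* Q_{s(f)} for every edge f of \overline{E}_{(H,S)}; T_f^* T_g =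 δ_{f,g} Q_{r(f)} for all edges f, g of \overline{E}_{(H,S)}; and Q_w = Σ_{s(f)=w} T_f T_f^* for every regular vertex w of \overline{E}_{(H,S)}. -/
namespace GraphIdeals

variable {V E : Type*}

def pathRel (r s : E → V) : E → E → Prop := fun e f => r e = s f

/-- A subset `H` of vertices is hereditary if `s(e) ∈ H` implies `r(e) ∈ H`. -/
def Hereditary (r s : E → V) (H : Set V) : Prop := ∀ e : E, s e ∈ H → r e ∈ H

/-- A vertex is regular if it emits a finite nonzero number of edges. -/
def Regular (s : E → V) (v : V) : Prop := (s ⁻¹' {v}).Finite ∧ (s ⁻¹' {v}).Nonempty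

/-- A hereditary set `H` is saturated if every regular vertex all of whose emitted
edges have range in `H` belongs to `H`. -/
def Saturated (r s : E → V) (H : Set V) : Prop :=
  ∀ v : V, Regular s v → (∀ e : E, s e = v → r e ∈ H) → v ∈ H

/-- The set of breaking vertices of `H`. -/
def breakingVertices (r s : E → V) (H : Set V) : Set V :=
  {v | (s ⁻¹' {v}).Infinite ∧ {e : E | s e = v ∧ r e ∉ H}.Finite ∧
      {e : E | s e = v ∧ r e ∉ H}.Nonempty}

/-- `F₁(H,S)`: paths `e₁ ⋯ eₙ` of length `≥ 1` with `r(eₙ) ∈ H` and `s(eₙ) ∉ H ∪ S`. -/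
def F1 (r s : E → V) (H S : Set V) : Set (List E) :=
  {p | ∃ h : p ≠ [], p.Chain' (pathRel r s) ∧
        r (p.getLast h) ∈ H ∧ s (p.getLast h) ∉ H ∪ S}

/-- `F₂(H,S)`: paths of length `≥ 1` with range in `S`. -/
def F2 (r s : E → V) (H S : Set V) : Set (List E) :=
  {p | ∃ h : p ≠ [], p.Chain' (pathRel r s) ∧ r (p.getLast h) ∈ S}

/-- Vertices of the graph `Ē_{(H,S)}`. -/
abbrev BarV (r s : E → V) (H S : Set V) : Type _ :=
  ({v : V // v ∈ H} ⊕ {v : V // v ∈ S}) ⊕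
    ({p : List E // p ∈ F1 r s H S} ⊕ {p : List E // p ∈ F2 r s H S})

/-- Edges of the graph `Ē_{(H,S)}`. -/
abbrev BarE (r s : E → V) (H S : Set V) : Type _ :=
  ({e : E // s e ∈ H} ⊕ {e : E // s e ∈ S ∧ r e ∈ H}) ⊕
    ({p : List E // p ∈ F1 r s H S} ⊕ {p : List E // p ∈ F2 r s H S})

/-- The source map of `Ē_{(H,S)}`. -/
def barS (r s : E → V) (H S : Set V) : BarE r s H S → BarV r s H S
  | .inl (.inl e) => .inl (.inl ⟨s e.1, e.2⟩)
  | .inl (.inr e) => .inl (.inr ⟨s e.1, e.2.1⟩)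
  | .inr (.inl p) => .inr (.inl p)
  | .inr (.inr p) => .inr (.inr p)

/-- The range map of `Ē_{(H,S)}` (well defined since `H` is hereditary). -/
def barR (r s : E → V) (H S : Set V) (hH : Hereditary r s H) :
    BarE r s H S → BarV r s H S
  | .inl (.inl e) => .inl (.inl ⟨r e.1, hH e.1 e.2⟩)
  | .inl (.inr e) => .inl (.inl ⟨r e.1, e.2.2⟩)
  | .inr (.inl p) => .inl (.inl ⟨r (p.1.getLast p.2.choose), p.2.choose_spec.2.1⟩)
  | .inr (.inr p) => .inl (.inr ⟨r (p.1.getLast p.2.choose), p.2.choose_spec.2⟩)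


section Leavitt

variable {A : Type*} [NonUnitalRing A]

/-- The element `S_α = S_{e₁} ⋯ S_{eₙ}` associated to a path `α = e₁ ⋯ eₙ`
(with junk value `0` on the empty list). -/
def sPath (Se : E → A) : List E → A
  | [] => 0
  | e :: es => es.foldl (fun a f => a * Se f) (Se e)

/-- The gap idempotent `P_v^H = P_v − ∑_{s(e) = v, r(e) ∉ H} S_e S_e*`. -/
noncomputable def gapIdem (r s : E → V) (P : V → A) (Se St : E → A) (H : Set V) (v : V)
    (hfin : {e : E | s e = v ∧ r e ∉ H}.Finite) : A :=
  P v - ∑ e ∈ hfin.toFinset, Se e * St e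

/-- The idempotents `Q_w`, for `w` a vertex of `Ē_{(H,S)}`:
`Q_w = P_w` for `w ∈ H`; `Q_w = P_w^H` for `w ∈ S`; `Q_α = S_α S_α*` for `α ∈ F₁`;
`Q_α = S_α P_{r(α)}^H S_α*` for `α ∈ F₂`.  (Here `S_α* = S_{eₙ}* ⋯ S_{e₁}*` is
implemented as the product of the `S_e*` along the reversed path.) -/
noncomputable def QL (r s : E → V) (H S : Set V) (hS : S ⊆ breakingVertices r s H)
    (P : V → A) (Se St : E → A) : BarV r s H S → A
  | .inl (.inl v) => P v.1
  | .inl (.inr v) => gapIdem r s P Se St H v.1 ((hS v.2).2.1)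
  | .inr (.inl p) => sPath Se p.1 * sPath St p.1.reverse
  | .inr (.inr p) => sPath Se p.1 *
      gapIdem r s P Se St H (r (p.1.getLast p.2.choose)) ((hS p.2.choose_spec.2).2.1) *
      sPath St p.1.reverse

/-- The elements `T_f`, for `f` an edge of `Ē_{(H,S)}`:
`T_e = S_e` for `e ∈ E¹`; `T_ā = S_α` for `α ∈ F₁`; `T_ā = S_α P_{r(α)}^H` for `α ∈ F₂`. -/
noncomputable def TL (r s : E → V) (H S : Set V) (hS : S ⊆ breakingVertices r s H)
    (P : V → A) (Se St : E → A) : BarE r s H S → A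
  | .inl (.inl e) => Se e.1
  | .inl (.inr e) => Se e.1
  | .inr (.inl p) => sPath Se p.1
  | .inr (.inr p) => sPath Se p.1 *
      gapIdem r s P Se St H (r (p.1.getLast p.2.choose)) ((hS p.2.choose_spec.2).2.1)

/-- The elements `T_f^*`, for `f` an edge of `Ē_{(H,S)}`:
`T_e^* = S_e*` for `e ∈ E¹`; `T_ā^* = S_α*` for `α ∈ F₁`;
`T_ā^* = P_{r(α)}^H S_α*` for `α ∈ F₂`. -/
noncomputable def TLst (r s : E → V) (H S : Set V) (hS : S ⊆ breakingVertices r s H)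
    (P : V → A) (Se St : E → A) : BarE r s H S → A
  | .inl (.inl e) => St e.1
  | .inl (.inr e) => St e.1
  | .inr (.inl p) => sPath St p.1.reverse
  | .inr (.inr p) =>
      gapIdem r s P Se St H (r (p.1.getLast p.2.choose)) ((hS p.2.choose_spec.2).2.1) *
      sPath St p.1.reverse

/-- The defining relations of a Leavitt family of a graph. -/
structure LeavittFamily (r s : E → V) (P : V → A) (Se St : E → A) : Prop where
  orth : ∀ v w : V, v ≠ w → P v * P w = 0
  idem : ∀ v : V, P v * P v = P v
  source_mul : ∀ e : E, P (s e) * Se e = Se e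
  mul_range : ∀ e : E, Se e * P (r e) = Se e
  range_mul_star : ∀ e : E, P (r e) * St e = St e
  star_mul_source : ∀ e : E, St e * P (s e) = St e
  star_mul_of_ne : ∀ e f : E, e ≠ f → St e * Se f = 0
  star_mul_self : ∀ e : E, St e * Se e = P (r e)
  sum_eq : ∀ v : V, ∀ hfin : (s ⁻¹' {v}).Finite, (s ⁻¹' {v}).Nonempty →
    P v = ∑ e ∈ hfin.toFinset, Se e * St e

section Paths

theorem sPath_cons (Se : E → A) (e : E) {l : List E} (hl : l ≠ []) :
    sPath Se (e :: l) = Se e * sPath Se l := by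
  have key : ∀ (l : List E) (a b : A),
      l.foldl (fun a f => a * Se f) (a * b) = a * l.foldl (fun a f => a * Se f) b := by
    intro l
    induction l with
    | nil => intro a b; rfl
    | cons f l ih => intro a b; simp only [List.foldl_cons, mul_assoc, ih]
  cases l with
  | nil => exact absurd rfl hl
  | cons f l => simp only [sPath, List.foldl_cons, key]

theorem sPath_append (Se : E → A) {l m : List E} (hl : l ≠ []) (hm : m ≠ []) :
    sPath Se (l ++ m) = sPath Se l * sPath Se m := by
  induction l with
  | nil => exact absurd rfl hl
  | cons e l ih =>
    rcases eq_or_ne l [] with rfl | hl'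
    · exact sPath_cons Se e hm
    · rw [List.cons_append, sPath_cons Se e (by simp [hm]), ih hl', sPath_cons Se e hl',
        mul_assoc]

theorem sPath_reverse_append (St : E → A) {l m : List E} (hl : l ≠ []) (hm : m ≠ []) :
    sPath St (l ++ m).reverse = sPath St m.reverse * sPath St l.reverse := by
  rw [List.reverse_append, sPath_append St (by simpa) (by simpa)]

theorem sPath_reverse_cons (St : E → A) (e : E) {l : List E} (hl : l ≠ []) :
    sPath St (e :: l).reverse = sPath St l.reverse * St e :=
  sPath_reverse_append St (l := [e]) (by simp) hl

variable {r s : E → V} {P : V → A} {Se St : E → A}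

theorem LeavittFamily.range_mul_sPath (h : LeavittFamily r s P Se St) {e : E} {l : List E}
    (hl : l ≠ []) (hc : (e :: l).IsChain (pathRel r s)) :
    P (r e) * sPath Se l = sPath Se l := by
  cases l with
  | nil => exact absurd rfl hl
  | cons f l =>
    have hef : r e = s f := (List.isChain_cons_cons.1 hc).1
    rcases eq_or_ne l [] with rfl | hl'
    · rw [hef]; exact h.source_mul f
    · rw [hef, sPath_cons Se f hl', ← mul_assoc, h.source_mul]

theorem LeavittFamily.sPath_reverse_mul_range (h : LeavittFamily r s P Se St) {e : E}
    {l : List E} (hl : l ≠ []) (hc : (e :: l).IsChain (pathRel r s)) :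
    sPath St l.reverse * P (r e) = sPath St l.reverse := by
  cases l with
  | nil => exact absurd rfl hl
  | cons f l =>
    have hef : r e = s f := (List.isChain_cons_cons.1 hc).1
    rcases eq_or_ne l [] with rfl | hl'
    · rw [hef]; exact h.star_mul_source f
    · rw [hef, sPath_reverse_cons St f hl', mul_assoc, h.star_mul_source]

theorem LeavittFamily.sPath_mul_range (h : LeavittFamily r s P Se St) {l : List E}
    (hl : l ≠ []) : sPath Se l * P (r (l.getLast hl)) = sPath Se l := by
  induction l with
  | nil => exact absurd rfl hl
  | cons e l ih =>
    rcases eq_or_ne l [] with rfl | hl'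
    · exact h.mul_range e
    · rw [sPath_cons Se e hl', List.getLast_cons hl', mul_assoc, ih]

theorem LeavittFamily.range_mul_sPath_reverse (h : LeavittFamily r s P Se St) {l : List E}
    (hl : l ≠ []) : P (r (l.getLast hl)) * sPath St l.reverse = sPath St l.reverse := by
  induction l with
  | nil => exact absurd rfl hl
  | cons e l ih =>
    rcases eq_or_ne l [] with rfl | hl'
    · exact h.range_mul_star e
    · rw [sPath_reverse_cons St e hl', List.getLast_cons hl', ← mul_assoc, ih]

theorem LeavittFamily.sPath_reverse_mul_self (h : LeavittFamily r s P Se St) {l : List E}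
    (hl : l ≠ []) (hc : l.IsChain (pathRel r s)) :
    sPath St l.reverse * sPath Se l = P (r (l.getLast hl)) := by
  induction l with
  | nil => exact absurd rfl hl
  | cons e l ih =>
    rcases eq_or_ne l [] with rfl | hl'
    · exact h.star_mul_self e
    · rw [sPath_reverse_cons St e hl', sPath_cons Se e hl', List.getLast_cons hl',
        ← ih hl' hc.tail, mul_assoc, ← mul_assoc (St e), h.star_mul_self,
        h.range_mul_sPath hl' hc]

theorem LeavittFamily.sPath_reverse_mul_append (h : LeavittFamily r s P Se St) {l m : List E}
    (hl : l ≠ []) (hm : m ≠ []) (hc : (l ++ m).IsChain (pathRel r s)) :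
    sPath St l.reverse * sPath Se (l ++ m) = sPath Se m := by
  have hc' : (l.getLast hl :: m).IsChain (pathRel r s) := by
    rw [← List.dropLast_append_getLast hl, List.append_assoc] at hc
    exact hc.right_of_append
  rw [sPath_append Se hl hm, ← mul_assoc, h.sPath_reverse_mul_self hl hc.left_of_append,
    h.range_mul_sPath hm hc']

theorem LeavittFamily.sPath_reverse_append_mul (h : LeavittFamily r s P Se St) {l m : List E}
    (hl : l ≠ []) (hm : m ≠ []) (hc : (l ++ m).IsChain (pathRel r s)) :
    sPath St (l ++ m).reverse * sPath Se l = sPath St m.reverse := by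
  have hc' : (l.getLast hl :: m).IsChain (pathRel r s) := by
    rw [← List.dropLast_append_getLast hl, List.append_assoc] at hc
    exact hc.right_of_append
  rw [sPath_reverse_append St hl hm, mul_assoc,
    h.sPath_reverse_mul_self hl hc.left_of_append, h.sPath_reverse_mul_range hm hc']

/-- `S_α* S_β` vanishes unless one of the paths `α`, `β` extends the other. -/
theorem LeavittFamily.prefix_or_sPath_reverse_mul_eq_zero (h : LeavittFamily r s P Se St)
    {l m : List E} (hl : l ≠ []) (hm : m ≠ []) (hcm : m.IsChain (pathRel r s)) :
    l <+: m ∨ m <+: l ∨ sPath St l.reverse * sPath Se m = 0 := by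
  induction l generalizing m with
  | nil => exact absurd rfl hl
  | cons e l ih =>
    cases m with
    | nil => exact absurd rfl hm
    | cons f m =>
      have hzero : e ≠ f → sPath St (e :: l).reverse * sPath Se (f :: m) = 0 := by
        intro hef
        have h1 : St e * sPath Se (f :: m) = 0 := by
          rcases eq_or_ne m [] with rfl | hm'
          · exact h.star_mul_of_ne e f hef
          · rw [sPath_cons Se f hm', ← mul_assoc, h.star_mul_of_ne e f hef, zero_mul]
        rcases eq_or_ne l [] with rfl | hl'
        · exact h1
        · rw [sPath_reverse_cons St e hl', mul_assoc, h1, mul_zero]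
      by_cases hef : e = f
      · subst hef
        rcases eq_or_ne l [] with rfl | hl'
        · exact Or.inl (by simp)
        rcases eq_or_ne m [] with rfl | hm'
        · exact Or.inr (Or.inl (by simp))
        rcases ih hl' hm' hcm.tail with h1 | h1 | h1
        · exact Or.inl ((List.prefix_cons_inj e).2 h1)
        · exact Or.inr (Or.inl ((List.prefix_cons_inj e).2 h1))
        · refine Or.inr (Or.inr ?_)
          rw [sPath_reverse_cons St e hl', sPath_cons Se e hm', mul_assoc,
            ← mul_assoc (St e), h.star_mul_self, h.range_mul_sPath hm' hcm, h1]
      · exact Or.inr (Or.inr (hzero hef))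

end Paths

section Gap

variable {r s : E → V} {P : V → A} {Se St : E → A} {H : Set V} {v : V}

theorem LeavittFamily.vertex_mul_gapIdem (h : LeavittFamily r s P Se St)
    (hfin : {e : E | s e = v ∧ r e ∉ H}.Finite) :
    P v * gapIdem r s P Se St H v hfin = gapIdem r s P Se St H v hfin := by
  rw [gapIdem, mul_sub, h.idem, Finset.mul_sum]
  congr 1
  refine Finset.sum_congr rfl fun e he => ?_
  obtain ⟨rfl, -⟩ := hfin.mem_toFinset.1 he
  rw [← mul_assoc, h.source_mul]

theorem LeavittFamily.gapIdem_mul_vertex (h : LeavittFamily r s P Se St)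
    (hfin : {e : E | s e = v ∧ r e ∉ H}.Finite) :
    gapIdem r s P Se St H v hfin * P v = gapIdem r s P Se St H v hfin := by
  rw [gapIdem, sub_mul, h.idem, Finset.sum_mul]
  congr 1
  refine Finset.sum_congr rfl fun e he => ?_
  obtain ⟨rfl, -⟩ := hfin.mem_toFinset.1 he
  rw [mul_assoc, h.star_mul_source]

theorem LeavittFamily.gapIdem_mul_of_range_notMem (h : LeavittFamily r s P Se St)
    (hfin : {e : E | s e = v ∧ r e ∉ H}.Finite) {f : E} (hs : s f = v) (hr : r f ∉ H) :
    gapIdem r s P Se St H v hfin * Se f = 0 := by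
  subst hs
  rw [gapIdem, sub_mul, h.source_mul, Finset.sum_mul, Finset.sum_eq_single f, mul_assoc,
    h.star_mul_self, h.mul_range, sub_self]
  · intro e _ hef
    rw [mul_assoc, h.star_mul_of_ne e f hef, mul_zero]
  · exact fun hf => absurd (hfin.mem_toFinset.2 ⟨rfl, hr⟩) hf

theorem LeavittFamily.star_mul_gapIdem_of_range_notMem (h : LeavittFamily r s P Se St)
    (hfin : {e : E | s e = v ∧ r e ∉ H}.Finite) {f : E} (hs : s f = v) (hr : r f ∉ H) :
    St f * gapIdem r s P Se St H v hfin = 0 := by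
  subst hs
  rw [gapIdem, mul_sub, h.star_mul_source, Finset.mul_sum, Finset.sum_eq_single f, ← mul_assoc,
    h.star_mul_self, h.range_mul_star, sub_self]
  · intro e _ hef
    rw [← mul_assoc, h.star_mul_of_ne f e hef.symm, zero_mul]
  · exact fun hf => absurd (hfin.mem_toFinset.2 ⟨rfl, hr⟩) hf

theorem LeavittFamily.gapIdem_mul_of_range_mem (h : LeavittFamily r s P Se St)
    (hfin : {e : E | s e = v ∧ r e ∉ H}.Finite) {f : E} (hs : s f = v) (hr : r f ∈ H) :
    gapIdem r s P Se St H v hfin * Se f = Se f := by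
  subst hs
  rw [gapIdem, sub_mul, h.source_mul, Finset.sum_mul, Finset.sum_eq_zero, sub_zero]
  intro e he
  rw [mul_assoc, h.star_mul_of_ne e f, mul_zero]
  rintro rfl
  exact (hfin.mem_toFinset.1 he).2 hr

theorem LeavittFamily.star_mul_gapIdem_of_range_mem (h : LeavittFamily r s P Se St)
    (hfin : {e : E | s e = v ∧ r e ∉ H}.Finite) {f : E} (hs : s f = v) (hr : r f ∈ H) :
    St f * gapIdem r s P Se St H v hfin = St f := by
  subst hs
  rw [gapIdem, mul_sub, h.star_mul_source, Finset.mul_sum, Finset.sum_eq_zero, sub_zero]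
  intro e he
  rw [← mul_assoc, h.star_mul_of_ne f e, zero_mul]
  rintro rfl
  exact (hfin.mem_toFinset.1 he).2 hr

theorem LeavittFamily.gapIdem_mul_self (h : LeavittFamily r s P Se St)
    (hfin : {e : E | s e = v ∧ r e ∉ H}.Finite) :
    gapIdem r s P Se St H v hfin * gapIdem r s P Se St H v hfin =
      gapIdem r s P Se St H v hfin := by
  conv_lhs => rhs; rw [gapIdem]
  rw [mul_sub, h.gapIdem_mul_vertex, Finset.mul_sum, Finset.sum_eq_zero, sub_zero]
  intro e he
  obtain ⟨hs, hr⟩ := hfin.mem_toFinset.1 he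
  rw [← mul_assoc, h.gapIdem_mul_of_range_notMem hfin hs hr, zero_mul]

end Gap

section BarPaths

variable {r s : E → V} {H S : Set V}

theorem disjoint_of_subset_breakingVertices (hH : Hereditary r s H)
    (hS : S ⊆ breakingVertices r s H) : Disjoint H S := by
  refine Set.disjoint_left.2 fun v hvH hvS => ?_
  obtain ⟨e, rfl, he⟩ := (hS hvS).2.2
  exact he (hH e hvH)

/-- The paths in `F₁(H,S)` or `F₂(H,S)`. -/
def barPaths (r s : E → V) (H S : Set V) : Set (List E) := F1 r s H S ∪ F2 r s H S

theorem ne_nil_of_mem_barPaths {p : List E} (hp : p ∈ barPaths r s H S) : p ≠ [] :=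
  hp.elim (fun h => h.1) (fun h => h.1)

theorem isChain_of_mem_barPaths {p : List E} (hp : p ∈ barPaths r s H S) :
    p.IsChain (pathRel r s) :=
  hp.elim (fun h => h.2.1) (fun h => h.2.1)

theorem mem_barPaths_of_append {l m : List E} (h : l ++ m ∈ barPaths r s H S) (hm : m ≠ []) :
    m ∈ barPaths r s H S := by
  have hc := (isChain_of_mem_barPaths h).right_of_append
  rcases h with ⟨hne, -, h1, h2⟩ | ⟨hne, -, h1⟩
  · rw [List.getLast_append_of_ne_nil _ hm] at h1 h2
    exact Or.inl ⟨hm, hc, h1, h2⟩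
  · rw [List.getLast_append_of_ne_nil _ hm] at h1
    exact Or.inr ⟨hm, hc, h1⟩

theorem source_getLast_mem (hH : Hereditary r s H) {e : E} {l : List E}
    (hc : (e :: l).IsChain (pathRel r s)) (he : s e ∈ H) :
    s ((e :: l).getLast (List.cons_ne_nil e l)) ∈ H := by
  induction l generalizing e with
  | nil => exact he
  | cons f l ih =>
    obtain ⟨hef, hc'⟩ := List.isChain_cons_cons.1 hc
    rw [List.getLast_cons (List.cons_ne_nil f l)]
    exact ih hc' (hef ▸ hH e he)

theorem source_notMem_of_cons_mem_barPaths (hH : Hereditary r s H) (hHS : Disjoint H S) {e : E}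
    {l : List E} (h : e :: l ∈ barPaths r s H S) : s e ∉ H := by
  intro he
  have hlast := source_getLast_mem hH (isChain_of_mem_barPaths h) he
  rcases h with ⟨_, -, -, h2⟩ | ⟨_, -, h1⟩
  · exact h2 (Or.inl hlast)
  · exact Set.disjoint_left.1 hHS (hH _ hlast) h1

theorem range_notMem_of_cons_mem_barPaths (hH : Hereditary r s H) (hHS : Disjoint H S) {e : E}
    {l : List E} (h : e :: l ∈ barPaths r s H S) (he : s e ∈ S) : r e ∉ H := by
  intro hr
  cases l with
  | nil =>
    rcases h with ⟨_, -, -, h2⟩ | ⟨_, -, h1⟩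
    · exact h2 (Or.inr he)
    · exact Set.disjoint_left.1 hHS hr h1
  | cons f l =>
    have hef : r e = s f := (List.isChain_cons_cons.1 (isChain_of_mem_barPaths h)).1
    exact source_notMem_of_cons_mem_barPaths hH hHS
      (mem_barPaths_of_append (l := [e]) h (List.cons_ne_nil f l)) (hef ▸ hr)

/-- The path underlying a vertex of `Ē_{(H,S)}` in `F₁(H,S) ⊔ F₂(H,S)`. -/
def barPath (r s : E → V) (H S : Set V) :
    {p : List E // p ∈ F1 r s H S} ⊕ {p : List E // p ∈ F2 r s H S} → List E :=
  Sum.elim Subtype.val Subtype.val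

theorem barPath_mem (p : {p : List E // p ∈ F1 r s H S} ⊕ {p : List E // p ∈ F2 r s H S}) :
    barPath r s H S p ∈ barPaths r s H S := by
  rcases p with p | p
  · exact Or.inl p.2
  · exact Or.inr p.2

theorem barPath_injective (hHS : Disjoint H S) : Function.Injective (barPath r s H S) := by
  have key : ∀ p : List E, p ∈ F1 r s H S → p ∉ F2 r s H S :=
    fun p h1 h2 => Set.disjoint_left.1 hHS h1.choose_spec.2.1 h2.choose_spec.2
  rintro (⟨p, hp⟩ | ⟨p, hp⟩) (⟨q, hq⟩ | ⟨q, hq⟩) (rfl : p = q)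
  · rfl
  · exact absurd hq (key p hp)
  · exact absurd hp (key p hq)
  · rfl

/-- The range of the edge `ā`, as an element of `H ⊔ S`. -/
def barRange (r s : E → V) (H S : Set V) :
    {p : List E // p ∈ F1 r s H S} ⊕ {p : List E // p ∈ F2 r s H S} →
      {v : V // v ∈ H} ⊕ {v : V // v ∈ S}
  | .inl p => .inl ⟨r (p.1.getLast p.2.choose), p.2.choose_spec.2.1⟩
  | .inr p => .inr ⟨r (p.1.getLast p.2.choose), p.2.choose_spec.2⟩

/-- The vertex of the original graph underlying an element of `H ⊔ S`. -/
def baseVertex (H S : Set V) : {v : V // v ∈ H} ⊕ {v : V // v ∈ S} → V :=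
  Sum.elim Subtype.val Subtype.val

theorem baseVertex_injective (hHS : Disjoint H S) : Function.Injective (baseVertex H S) := by
  rintro (⟨v, hv⟩ | ⟨v, hv⟩) (⟨w, hw⟩ | ⟨w, hw⟩) (rfl : v = w)
  · rfl
  · exact (Set.disjoint_left.1 hHS hv hw).elim
  · exact (Set.disjoint_left.1 hHS hw hv).elim
  · rfl

theorem baseVertex_barRange
    (p : {p : List E // p ∈ F1 r s H S} ⊕ {p : List E // p ∈ F2 r s H S}) :
    baseVertex H S (barRange r s H S p) =
      r ((barPath r s H S p).getLast (ne_nil_of_mem_barPaths (barPath_mem p))) := by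
  rcases p with p | p <;> rfl

end BarPaths

section BarFamily

variable {r s : E → V} {H S : Set V} {hS : S ⊆ breakingVertices r s H} {P : V → A}
  {Se St : E → A}

theorem LeavittFamily.QL_inl_mul_self (h : LeavittFamily r s P Se St)
    (x : {v : V // v ∈ H} ⊕ {v : V // v ∈ S}) :
    QL r s H S hS P Se St (.inl x) * QL r s H S hS P Se St (.inl x) =
      QL r s H S hS P Se St (.inl x) := by
  rcases x with x | x
  · exact h.idem _
  · exact h.gapIdem_mul_self _

theorem LeavittFamily.vertex_mul_QL_inl (h : LeavittFamily r s P Se St)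
    (x : {v : V // v ∈ H} ⊕ {v : V // v ∈ S}) :
    P (baseVertex H S x) * QL r s H S hS P Se St (.inl x) =
      QL r s H S hS P Se St (.inl x) := by
  rcases x with x | x
  · exact h.idem _
  · exact h.vertex_mul_gapIdem _

theorem LeavittFamily.QL_inl_mul_vertex (h : LeavittFamily r s P Se St)
    (x : {v : V // v ∈ H} ⊕ {v : V // v ∈ S}) :
    QL r s H S hS P Se St (.inl x) * P (baseVertex H S x) =
      QL r s H S hS P Se St (.inl x) := by
  rcases x with x | x
  · exact h.idem _
  · exact h.gapIdem_mul_vertex _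

theorem LeavittFamily.QL_inl_mul_of_ne (h : LeavittFamily r s P Se St) (hHS : Disjoint H S)
    {x y : {v : V // v ∈ H} ⊕ {v : V // v ∈ S}} (hxy : x ≠ y) :
    QL r s H S hS P Se St (.inl x) * QL r s H S hS P Se St (.inl y) = 0 := by
  rw [← h.QL_inl_mul_vertex x, ← h.vertex_mul_QL_inl y, mul_assoc, ← mul_assoc (P _),
    h.orth _ _ ((baseVertex_injective hHS).ne hxy), zero_mul, mul_zero]

theorem LeavittFamily.QL_inl_mul_edge_eq_zero (h : LeavittFamily r s P Se St)
    (x : {v : V // v ∈ H} ⊕ {v : V // v ∈ S}) {f : E} (hf : s f ∉ H)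
    (hf' : s f ∈ S → r f ∉ H) : QL r s H S hS P Se St (.inl x) * Se f = 0 := by
  by_cases hx : baseVertex H S x = s f
  · rcases x with x | x
    · exact absurd (hx ▸ x.2) hf
    · exact h.gapIdem_mul_of_range_notMem _ hx.symm (hf' (hx ▸ x.2))
  · rw [← h.QL_inl_mul_vertex x, mul_assoc, ← h.source_mul f, ← mul_assoc (P _),
      h.orth _ _ hx, zero_mul, mul_zero]

theorem LeavittFamily.star_mul_QL_inl_eq_zero (h : LeavittFamily r s P Se St)
    (x : {v : V // v ∈ H} ⊕ {v : V // v ∈ S}) {f : E} (hf : s f ∉ H)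
    (hf' : s f ∈ S → r f ∉ H) : St f * QL r s H S hS P Se St (.inl x) = 0 := by
  by_cases hx : baseVertex H S x = s f
  · rcases x with x | x
    · exact absurd (hx ▸ x.2) hf
    · exact h.star_mul_gapIdem_of_range_notMem _ hx.symm (hf' (hx ▸ x.2))
  · rw [← h.vertex_mul_QL_inl x, ← mul_assoc, ← h.star_mul_source f, mul_assoc (St f),
      h.orth _ _ (Ne.symm hx), mul_zero, zero_mul]

theorem LeavittFamily.QL_inl_mul_sPath (h : LeavittFamily r s P Se St)
    (hH : Hereditary r s H) (x : {v : V // v ∈ H} ⊕ {v : V // v ∈ S}) {p : List E}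
    (hp : p ∈ barPaths r s H S) : QL r s H S hS P Se St (.inl x) * sPath Se p = 0 := by
  have hHS := disjoint_of_subset_breakingVertices hH hS
  cases p with
  | nil => exact mul_zero _
  | cons f l =>
    have hz := h.QL_inl_mul_edge_eq_zero (hS := hS) x
      (source_notMem_of_cons_mem_barPaths hH hHS hp)
      (range_notMem_of_cons_mem_barPaths hH hHS hp)
    rcases eq_or_ne l [] with rfl | hl
    · exact hz
    · rw [sPath_cons Se f hl, ← mul_assoc, hz, zero_mul]

theorem LeavittFamily.sPath_reverse_mul_QL_inl (h : LeavittFamily r s P Se St)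
    (hH : Hereditary r s H) (x : {v : V // v ∈ H} ⊕ {v : V // v ∈ S}) {p : List E}
    (hp : p ∈ barPaths r s H S) :
    sPath St p.reverse * QL r s H S hS P Se St (.inl x) = 0 := by
  have hHS := disjoint_of_subset_breakingVertices hH hS
  cases p with
  | nil => exact zero_mul _
  | cons f l =>
    have hz := h.star_mul_QL_inl_eq_zero (hS := hS) x
      (source_notMem_of_cons_mem_barPaths hH hHS hp)
      (range_notMem_of_cons_mem_barPaths hH hHS hp)
    rcases eq_or_ne l [] with rfl | hl
    · exact hz
    · rw [sPath_reverse_cons St f hl, mul_assoc, hz, mul_zero]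

/-- The original edge underlying an edge of `Ē_{(H,S)}` that is not of the form `ā`. -/
def baseEdge (r s : E → V) (H S : Set V) :
    {e : E // s e ∈ H} ⊕ {e : E // s e ∈ S ∧ r e ∈ H} → E :=
  Sum.elim Subtype.val Subtype.val

theorem baseEdge_injective (hHS : Disjoint H S) : Function.Injective (baseEdge r s H S) := by
  rintro (⟨e, he⟩ | ⟨e, he⟩) (⟨f, hf⟩ | ⟨f, hf⟩) (rfl : e = f)
  · rfl
  · exact (Set.disjoint_left.1 hHS he hf.1).elim
  · exact (Set.disjoint_left.1 hHS hf he.1).elim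
  · rfl

theorem baseEdge_ne_of_cons_mem_barPaths (hH : Hereditary r s H) (hHS : Disjoint H S)
    (e : {e : E // s e ∈ H} ⊕ {e : E // s e ∈ S ∧ r e ∈ H}) {f : E} {l : List E}
    (hp : f :: l ∈ barPaths r s H S) : baseEdge r s H S e ≠ f := by
  rintro rfl
  rcases e with e | e
  · exact source_notMem_of_cons_mem_barPaths hH hHS hp e.2
  · exact range_notMem_of_cons_mem_barPaths hH hHS hp e.2.1 e.2.2

theorem LeavittFamily.star_mul_sPath (h : LeavittFamily r s P Se St) (hH : Hereditary r s H)
    (hHS : Disjoint H S) (e : {e : E // s e ∈ H} ⊕ {e : E // s e ∈ S ∧ r e ∈ H}) {p : List E}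
    (hp : p ∈ barPaths r s H S) : St (baseEdge r s H S e) * sPath Se p = 0 := by
  cases p with
  | nil => exact mul_zero _
  | cons f l =>
    have hz := h.star_mul_of_ne _ _ (baseEdge_ne_of_cons_mem_barPaths hH hHS e hp)
    rcases eq_or_ne l [] with rfl | hl
    · exact hz
    · rw [sPath_cons Se f hl, ← mul_assoc, hz, zero_mul]

theorem LeavittFamily.sPath_reverse_mul_edge (h : LeavittFamily r s P Se St)
    (hH : Hereditary r s H) (hHS : Disjoint H S)
    (e : {e : E // s e ∈ H} ⊕ {e : E // s e ∈ S ∧ r e ∈ H}) {p : List E}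
    (hp : p ∈ barPaths r s H S) : sPath St p.reverse * Se (baseEdge r s H S e) = 0 := by
  cases p with
  | nil => exact zero_mul _
  | cons f l =>
    have hz := h.star_mul_of_ne _ _ (baseEdge_ne_of_cons_mem_barPaths hH hHS e hp).symm
    rcases eq_or_ne l [] with rfl | hl
    · exact hz
    · rw [sPath_reverse_cons St f hl, mul_assoc, hz, mul_zero]

variable (p q : {p : List E // p ∈ F1 r s H S} ⊕ {p : List E // p ∈ F2 r s H S})

theorem LeavittFamily.TL_inr (h : LeavittFamily r s P Se St) :
    TL r s H S hS P Se St (.inr p) =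
      sPath Se (barPath r s H S p) * QL r s H S hS P Se St (.inl (barRange r s H S p)) := by
  rcases p with p | p
  · exact (h.sPath_mul_range p.2.choose).symm
  · rfl

theorem LeavittFamily.TLst_inr (h : LeavittFamily r s P Se St) :
    TLst r s H S hS P Se St (.inr p) =
      QL r s H S hS P Se St (.inl (barRange r s H S p)) *
        sPath St (barPath r s H S p).reverse := by
  rcases p with p | p
  · exact (h.range_mul_sPath_reverse p.2.choose).symm
  · rfl

theorem LeavittFamily.QL_inr (h : LeavittFamily r s P Se St) :
    QL r s H S hS P Se St (.inr p) =
      TL r s H S hS P Se St (.inr p) * TLst r s H S hS P Se St (.inr p) := by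
  rcases p with p | p
  · rfl
  · rw [h.TL_inr, h.TLst_inr, mul_assoc, ← mul_assoc (QL _ _ _ _ _ _ _ _ _),
      h.QL_inl_mul_self, ← mul_assoc]
    rfl

theorem LeavittFamily.TL_inr_mul_QL (h : LeavittFamily r s P Se St) :
    TL r s H S hS P Se St (.inr p) * QL r s H S hS P Se St (.inl (barRange r s H S p)) =
      TL r s H S hS P Se St (.inr p) := by
  rw [h.TL_inr, mul_assoc, h.QL_inl_mul_self]

theorem LeavittFamily.QL_mul_TLst_inr (h : LeavittFamily r s P Se St) :
    QL r s H S hS P Se St (.inl (barRange r s H S p)) * TLst r s H S hS P Se St (.inr p) =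
      TLst r s H S hS P Se St (.inr p) := by
  rw [h.TLst_inr, ← mul_assoc, h.QL_inl_mul_self]

theorem LeavittFamily.TLst_inr_mul_self (h : LeavittFamily r s P Se St) :
    TLst r s H S hS P Se St (.inr p) * TL r s H S hS P Se St (.inr p) =
      QL r s H S hS P Se St (.inl (barRange r s H S p)) := by
  rw [h.TLst_inr, h.TL_inr, mul_assoc, ← mul_assoc (sPath _ _),
    h.sPath_reverse_mul_self (ne_nil_of_mem_barPaths (barPath_mem p))
      (isChain_of_mem_barPaths (barPath_mem p)),
    ← baseVertex_barRange p, h.vertex_mul_QL_inl, h.QL_inl_mul_self]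

variable {p q}

theorem LeavittFamily.TLst_inr_mul_of_ne (h : LeavittFamily r s P Se St)
    (hH : Hereditary r s H) (hpq : p ≠ q) :
    TLst r s H S hS P Se St (.inr p) * TL r s H S hS P Se St (.inr q) = 0 := by
  have hne := (barPath_injective (disjoint_of_subset_breakingVertices hH hS)).ne hpq
  have hp := barPath_mem p
  have hq := barPath_mem q
  rw [h.TLst_inr, h.TL_inr]
  generalize barRange r s H S p = x
  generalize barRange r s H S q = y
  generalize barPath r s H S p = l at *
  generalize barPath r s H S q = m at *
  have hl := ne_nil_of_mem_barPaths hp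
  have hm := ne_nil_of_mem_barPaths hq
  rw [mul_assoc, ← mul_assoc (sPath _ _)]
  rcases h.prefix_or_sPath_reverse_mul_eq_zero hl hm (isChain_of_mem_barPaths hq) with
    ⟨t, rfl⟩ | ⟨t, rfl⟩ | hz
  · have ht : t ≠ [] := by rintro rfl; simp at hne
    rw [h.sPath_reverse_mul_append hl ht (isChain_of_mem_barPaths hq), ← mul_assoc,
      h.QL_inl_mul_sPath hH x (mem_barPaths_of_append hq ht), zero_mul]
  · have ht : t ≠ [] := by rintro rfl; simp at hne
    rw [h.sPath_reverse_append_mul hm ht (isChain_of_mem_barPaths hp),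
      h.sPath_reverse_mul_QL_inl hH y (mem_barPaths_of_append hp ht), mul_zero]
  · rw [hz, zero_mul, mul_zero]

theorem LeavittFamily.QL_inl_mul_TL_inr (h : LeavittFamily r s P Se St)
    (hH : Hereditary r s H) (x : {v : V // v ∈ H} ⊕ {v : V // v ∈ S}) :
    QL r s H S hS P Se St (.inl x) * TL r s H S hS P Se St (.inr p) = 0 := by
  rw [h.TL_inr, ← mul_assoc, h.QL_inl_mul_sPath hH x (barPath_mem p), zero_mul]

theorem LeavittFamily.TLst_inr_mul_QL_inl (h : LeavittFamily r s P Se St)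
    (hH : Hereditary r s H) (x : {v : V // v ∈ H} ⊕ {v : V // v ∈ S}) :
    TLst r s H S hS P Se St (.inr p) * QL r s H S hS P Se St (.inl x) = 0 := by
  rw [h.TLst_inr, mul_assoc, h.sPath_reverse_mul_QL_inl hH x (barPath_mem p), mul_zero]

theorem LeavittFamily.QL_mul_self (h : LeavittFamily r s P Se St) (w : BarV r s H S) :
    QL r s H S hS P Se St w * QL r s H S hS P Se St w = QL r s H S hS P Se St w := by
  rcases w with x | p
  · exact h.QL_inl_mul_self x
  · rw [h.QL_inr, mul_assoc, ← mul_assoc (TLst _ _ _ _ _ _ _ _ _), h.TLst_inr_mul_self,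
      h.QL_mul_TLst_inr]

theorem LeavittFamily.QL_mul_of_ne (h : LeavittFamily r s P Se St) (hH : Hereditary r s H)
    {w w' : BarV r s H S} (hw : w ≠ w') :
    QL r s H S hS P Se St w * QL r s H S hS P Se St w' = 0 := by
  rcases w with x | p <;> rcases w' with y | q
  · exact h.QL_inl_mul_of_ne (disjoint_of_subset_breakingVertices hH hS) (by simpa using hw)
  · rw [h.QL_inr, ← mul_assoc, h.QL_inl_mul_TL_inr hH, zero_mul]
  · rw [h.QL_inr, mul_assoc, h.TLst_inr_mul_QL_inl hH, mul_zero]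
  · rw [h.QL_inr, h.QL_inr, mul_assoc, ← mul_assoc (TLst _ _ _ _ _ _ _ _ _),
      h.TLst_inr_mul_of_ne hH (by simpa using hw), zero_mul, mul_zero]

theorem TL_inl (e : {e : E // s e ∈ H} ⊕ {e : E // s e ∈ S ∧ r e ∈ H}) :
    TL r s H S hS P Se St (.inl e) = Se (baseEdge r s H S e) := by
  rcases e with e | e <;> rfl

theorem TLst_inl (e : {e : E // s e ∈ H} ⊕ {e : E // s e ∈ S ∧ r e ∈ H}) :
    TLst r s H S hS P Se St (.inl e) = St (baseEdge r s H S e) := by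
  rcases e with e | e <;> rfl

theorem barS_inr : barS r s H S (.inr p) = .inr p := by
  rcases p with p | p <;> rfl

theorem barR_inr (hH : Hereditary r s H) :
    barR r s H S hH (.inr p) = .inl (barRange r s H S p) := by
  rcases p with p | p <;> rfl

theorem LeavittFamily.QL_barS_mul_TL (h : LeavittFamily r s P Se St) (f : BarE r s H S) :
    QL r s H S hS P Se St (barS r s H S f) * TL r s H S hS P Se St f =
      TL r s H S hS P Se St f := by
  rcases f with (e | e) | p
  · exact h.source_mul _
  · exact h.gapIdem_mul_of_range_mem _ rfl e.2.2
  · rw [barS_inr, h.QL_inr, mul_assoc, h.TLst_inr_mul_self, h.TL_inr_mul_QL]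

theorem LeavittFamily.TL_mul_QL_barR (h : LeavittFamily r s P Se St) (hH : Hereditary r s H)
    (f : BarE r s H S) :
    TL r s H S hS P Se St f * QL r s H S hS P Se St (barR r s H S hH f) =
      TL r s H S hS P Se St f := by
  rcases f with (e | e) | p
  · exact h.mul_range _
  · exact h.mul_range _
  · rw [barR_inr, h.TL_inr_mul_QL]

theorem LeavittFamily.QL_barR_mul_TLst (h : LeavittFamily r s P Se St) (hH : Hereditary r s H)
    (f : BarE r s H S) :
    QL r s H S hS P Se St (barR r s H S hH f) * TLst r s H S hS P Se St f =
      TLst r s H S hS P Se St f := by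
  rcases f with (e | e) | p
  · exact h.range_mul_star _
  · exact h.range_mul_star _
  · rw [barR_inr, h.QL_mul_TLst_inr]

theorem LeavittFamily.TLst_mul_QL_barS (h : LeavittFamily r s P Se St) (f : BarE r s H S) :
    TLst r s H S hS P Se St f * QL r s H S hS P Se St (barS r s H S f) =
      TLst r s H S hS P Se St f := by
  rcases f with (e | e) | p
  · exact h.star_mul_source _
  · exact h.star_mul_gapIdem_of_range_mem _ rfl e.2.2
  · rw [barS_inr, h.QL_inr, ← mul_assoc, h.TLst_inr_mul_self, h.QL_mul_TLst_inr]

theorem LeavittFamily.TLst_mul_TL_of_ne (h : LeavittFamily r s P Se St)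
    (hH : Hereditary r s H) {f g : BarE r s H S} (hfg : f ≠ g) :
    TLst r s H S hS P Se St f * TL r s H S hS P Se St g = 0 := by
  have hHS := disjoint_of_subset_breakingVertices hH hS
  rcases f with e | p <;> rcases g with e' | q
  · rw [TL_inl, TLst_inl]
    exact h.star_mul_of_ne _ _ ((baseEdge_injective hHS).ne (by simpa using hfg))
  · rw [TLst_inl, h.TL_inr, ← mul_assoc, h.star_mul_sPath hH hHS e (barPath_mem q), zero_mul]
  · rw [TL_inl, h.TLst_inr, mul_assoc, h.sPath_reverse_mul_edge hH hHS e' (barPath_mem p),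
      mul_zero]
  · exact h.TLst_inr_mul_of_ne hH (by simpa using hfg)

theorem LeavittFamily.TLst_mul_TL_self (h : LeavittFamily r s P Se St) (hH : Hereditary r s H)
    (f : BarE r s H S) :
    TLst r s H S hS P Se St f * TL r s H S hS P Se St f =
      QL r s H S hS P Se St (barR r s H S hH f) := by
  rcases f with (e | e) | p
  · exact h.star_mul_self _
  · exact h.star_mul_self _
  · rw [barR_inr, h.TLst_inr_mul_self]

/-- A vertex of `S` emits infinitely many edges into `H`, so it is not regular in
`Ē_{(H,S)}`. -/
theorem infinite_setOf_barS_eq (hS : S ⊆ breakingVertices r s H) (v : {v : V // v ∈ S}) :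
    {f : BarE r s H S | barS r s H S f = .inl (.inr v)}.Infinite := by
  intro hfin
  obtain ⟨hinf, hout, -⟩ := hS v.2
  refine hinf ((hout.union ((hfin.preimage Sum.inl_injective.injOn).image
    (baseEdge r s H S))).subset fun e he => ?_)
  by_cases hr : r e ∈ H
  · obtain ⟨v, hv⟩ := v
    obtain rfl : s e = v := he
    exact Or.inr ⟨.inr ⟨e, hv, hr⟩, rfl, rfl⟩
  · exact Or.inl ⟨he, hr⟩

theorem LeavittFamily.QL_eq_sum (h : LeavittFamily r s P Se St) (w : BarV r s H S)
    (hfin : {f : BarE r s H S | barS r s H S f = w}.Finite)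
    (hne : {f : BarE r s H S | barS r s H S f = w}.Nonempty) :
    QL r s H S hS P Se St w =
      ∑ f ∈ hfin.toFinset, TL r s H S hS P Se St f * TLst r s H S hS P Se St f := by
  classical
  rcases w with (⟨v, hv⟩ | v) | p
  · have himage : {f : BarE r s H S | barS r s H S f = .inl (.inl ⟨v, hv⟩)} =
        {f | ∃ e : {e : E // s e ∈ H}, s e.1 = v ∧ .inl (.inl e) = f} := by
      ext f
      rcases f with (e | e) | p | p <;> simp [barS, -Subtype.exists]
    have hfin' : (s ⁻¹' {v}).Finite := by
      refine Set.Finite.subset ((hfin.preimage Sum.inl_injective.injOn).image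
        (baseEdge r s H S)) fun e he => ?_
      obtain rfl : s e = v := he
      exact ⟨.inl ⟨e, hv⟩, rfl, rfl⟩
    have hne' : (s ⁻¹' {v}).Nonempty := by
      rw [himage] at hne
      obtain ⟨-, e, he, -⟩ := hne
      exact ⟨e.1, he⟩
    refine (h.sum_eq v hfin' hne').trans (Finset.sum_bij
      (fun e he => .inl (.inl ⟨e, by
        rw [show s e = v from hfin'.mem_toFinset.1 he]; exact hv⟩)) ?_ ?_ ?_ ?_)
    · intro e he
      rw [hfin.mem_toFinset, himage]
      exact ⟨_, hfin'.mem_toFinset.1 he, rfl⟩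
    · intro e _ e' _ hee'
      simpa using hee'
    · intro f hf
      rw [hfin.mem_toFinset, himage] at hf
      obtain ⟨e, he, rfl⟩ := hf
      exact ⟨e.1, hfin'.mem_toFinset.2 he, rfl⟩
    · intro e _
      rfl
  · exact absurd hfin (infinite_setOf_barS_eq hS v)
  · have : hfin.toFinset = {.inr p} := by
      ext f
      rw [hfin.mem_toFinset, Finset.mem_singleton]
      rcases f with (e | e) | q | q <;> simp [barS, eq_comm]
    rw [this, Finset.sum_singleton, h.QL_inr]

end BarFamily

/-- If `{P_v, S_e, S_e*}` is a Leavitt `E`-family in an associative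
`K`-algebra `A`, `H` is saturated hereditary and `S ⊆ B_H`, then the family
`{Q_w, T_f, T_f^*}` defined above is a Leavitt `Ē_{(H,S)}`-family in `A`. -/
theorem QT_is_Leavitt_bar_family
    (K : Type*) [Field K] [Module K A] [SMulCommClass K A A] [IsScalarTower K A A]
    (r s : E → V) (H S : Set V) (hH : Hereditary r s H) (hSat : Saturated r s H)
    (hS : S ⊆ breakingVertices r s H)
    (P : V → A) (Se St : E → A)
    -- `{P_v}` are pairwise orthogonal idempotents
    (hPorth : ∀ v w : V, v ≠ w → P v * P w = 0)
    (hPidem : ∀ v : V, P v * P v = P v)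
    -- `P_{s(e)} S_e = S_e = S_e P_{r(e)}` and `P_{r(e)} S_e* = S_e* = S_e* P_{s(e)}`
    (hPS : ∀ e : E, P (s e) * Se e = Se e)
    (hSP : ∀ e : E, Se e * P (r e) = Se e)
    (hPSt : ∀ e : E, P (r e) * St e = St e)
    (hStP : ∀ e : E, St e * P (s e) = St e)
    -- `S_e* S_f = δ_{e,f} P_{r(e)}`
    (hStS : ∀ e f : E, e ≠ f → St e * Se f = 0)
    (hStSe : ∀ e : E, St e * Se e = P (r e))
    -- `P_v = ∑_{s(e) = v} S_e S_e*` for every regular vertex `v`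
    (hCK : ∀ v : V, ∀ hfin : (s ⁻¹' {v}).Finite, (s ⁻¹' {v}).Nonempty →
      P v = ∑ e ∈ hfin.toFinset, Se e * St e) :
    -- the `Q_w` are pairwise orthogonal idempotents
    (∀ w : BarV r s H S, QL r s H S hS P Se St w * QL r s H S hS P Se St w =
        QL r s H S hS P Se St w) ∧
    (∀ w w' : BarV r s H S, w ≠ w' →
        QL r s H S hS P Se St w * QL r s H S hS P Se St w' = 0) ∧
    -- `Q_{s(f)} T_f = T_f = T_f Q_{r(f)}`
    (∀ f : BarE r s H S,
        QL r s H S hS P Se St (barS r s H S f) * TL r s H S hS P Se St f =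
          TL r s H S hS P Se St f) ∧
    (∀ f : BarE r s H S,
        TL r s H S hS P Se St f * QL r s H S hS P Se St (barR r s H S hH f) =
          TL r s H S hS P Se St f) ∧
    -- `Q_{r(f)} T_f^* = T_f^* = T_f^* Q_{s(f)}`
    (∀ f : BarE r s H S,
        QL r s H S hS P Se St (barR r s H S hH f) * TLst r s H S hS P Se St f =
          TLst r s H S hS P Se St f) ∧
    (∀ f : BarE r s H S,
        TLst r s H S hS P Se St f * QL r s H S hS P Se St (barS r s H S f) =
          TLst r s H S hS P Se St f) ∧
    -- `T_f^* T_g = δ_{f,g} Q_{r(f)}`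
    (∀ f g : BarE r s H S, f ≠ g →
        TLst r s H S hS P Se St f * TL r s H S hS P Se St g = 0) ∧
    (∀ f : BarE r s H S,
        TLst r s H S hS P Se St f * TL r s H S hS P Se St f =
          QL r s H S hS P Se St (barR r s H S hH f)) ∧
    -- `Q_w = ∑_{s(f) = w} T_f T_f^*` for every regular vertex `w` of `Ē_{(H,S)}`
    (∀ w : BarV r s H S, ∀ hfin : {f : BarE r s H S | barS r s H S f = w}.Finite,
        {f : BarE r s H S | barS r s H S f = w}.Nonempty →
        QL r s H S hS P Se St w =
          ∑ f ∈ hfin.toFinset, TL r s H S hS P Se St f * TLst r s H S hS P Se St f) := by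
  have h : LeavittFamily r s P Se St :=
    ⟨hPorth, hPidem, hPS, hSP, hPSt, hStP, hStS, hStSe, hCK⟩
  exact ⟨h.QL_mul_self, fun _ _ => h.QL_mul_of_ne hH, h.QL_barS_mul_TL, h.TL_mul_QL_barR hH,
    h.QL_barR_mul_TLst hH, h.TLst_mul_QL_barS, fun _ _ => h.TLst_mul_TL_of_ne hH,
    h.TLst_mul_TL_self hH, h.QL_eq_sum⟩

end Leavitt

end GraphIdeals
end

section
/- Let E = (E⁰, E¹, r, s) be a directed graph, K a field, H ⊆ E⁰ a saturated hereditary subset, and S ⊆ B_H. In L_K(E), for each vertex w of \overline{E}_{(H,S)} define Q_w := w if w ∈ H; Q_w := w^H if w ∈ S; Q_w := αα* if w = α ∈ F₁(H,S); Q_w := α r(α)^H α* if w = α ∈ F₂(H,S); for each edge f of \overline{E}_{(H,S)} define T_f := f and T_f^* := f* if f ∈ E¹; T_f := α and T_f^* := α* if f = ā with α ∈ F₁(H,S); T_f := α r(α)^H and T_f^* := r(α)^H α* if f = ā with α ∈ F₂(H,S). Then the K-subalgebra of L_K(E) generated by {Q_w : w a vertex of \overline{E}_{(H,S)}} ∪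 {T_f, T_f^* : f an edge of \overline{E}_{(H,S)}} equals the two-sided ideal I_{(H,S)} of L_K(E) generated by {v : v ∈ H} ∪ {v^H : v ∈ S}. -/
namespace GraphIdeals

variable {V E : Type*}

section LPA

variable (K : Type*) [Field K]

/-- Generators of the Leavitt path algebra: a vertex `v`, a real edge `e`,
or a ghost edge `e*`. -/
abbrev LGen (V E : Type*) : Type _ := V ⊕ E ⊕ E

/-- The defining relations of the Leavitt path algebra of the graph
`(V, E, r, s)` with coefficients in `K`, imposed on the free associative
`K`-algebra on the generators `LGen V E`. -/
inductive LRel (r s : E → V) :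
    FreeAlgebra K (LGen V E) → FreeAlgebra K (LGen V E) → Prop
  | vertOrth {v w : V} (h : v ≠ w) :
      LRel r s (FreeAlgebra.ι K (Sum.inl v : LGen V E) *
        FreeAlgebra.ι K (Sum.inl w : LGen V E)) 0
  | vertIdem (v : V) :
      LRel r s (FreeAlgebra.ι K (Sum.inl v : LGen V E) *
        FreeAlgebra.ι K (Sum.inl v : LGen V E))
        (FreeAlgebra.ι K (Sum.inl v : LGen V E))
  | srcMul (e : E) :
      LRel r s (FreeAlgebra.ι K (Sum.inl (s e) : LGen V E) *
        FreeAlgebra.ι K (Sum.inr (Sum.inl e) : LGen V E))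
        (FreeAlgebra.ι K (Sum.inr (Sum.inl e) : LGen V E))
  | mulRng (e : E) :
      LRel r s (FreeAlgebra.ι K (Sum.inr (Sum.inl e) : LGen V E) *
        FreeAlgebra.ι K (Sum.inl (r e) : LGen V E))
        (FreeAlgebra.ι K (Sum.inr (Sum.inl e) : LGen V E))
  | rngMulStar (e : E) :
      LRel r s (FreeAlgebra.ι K (Sum.inl (r e) : LGen V E) *
        FreeAlgebra.ι K (Sum.inr (Sum.inr e) : LGen V E))
        (FreeAlgebra.ι K (Sum.inr (Sum.inr e) : LGen V E))
  | starMulSrc (e : E) :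
      LRel r s (FreeAlgebra.ι K (Sum.inr (Sum.inr e) : LGen V E) *
        FreeAlgebra.ι K (Sum.inl (s e) : LGen V E))
        (FreeAlgebra.ι K (Sum.inr (Sum.inr e) : LGen V E))
  | ck1Orth {e f : E} (h : e ≠ f) :
      LRel r s (FreeAlgebra.ι K (Sum.inr (Sum.inr e) : LGen V E) *
        FreeAlgebra.ι K (Sum.inr (Sum.inl f) : LGen V E)) 0
  | ck1 (e : E) :
      LRel r s (FreeAlgebra.ι K (Sum.inr (Sum.inr e) : LGen V E) *
        FreeAlgebra.ι K (Sum.inr (Sum.inl e) : LGen V E))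
        (FreeAlgebra.ι K (Sum.inl (r e) : LGen V E))
  | ck2 (v : V) (hfin : (s ⁻¹' {v}).Finite) (hne : (s ⁻¹' {v}).Nonempty) :
      LRel r s (FreeAlgebra.ι K (Sum.inl v : LGen V E))
        (∑ e ∈ hfin.toFinset,
          FreeAlgebra.ι K (Sum.inr (Sum.inl e) : LGen V E) *
          FreeAlgebra.ι K (Sum.inr (Sum.inr e) : LGen V E))

/-- The (unitalized) Leavitt path algebra: the quotient of the free associative
`K`-algebra on the generators by the Leavitt relations.  The Leavitt path algebra
proper is the non-unital subalgebra generated by the images of the generators; see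
`LPAvert`, `LPAedge`, `LPAghost`. -/
abbrev LPA (r s : E → V) : Type _ := RingQuot (LRel K r s)

/-- The vertex idempotent `v` in the Leavitt path algebra. -/
def vert (r s : E → V) (v : V) : LPA K r s :=
  RingQuot.mkAlgHom K (LRel K r s) (FreeAlgebra.ι K (Sum.inl v : LGen V E))

/-- The real edge `e` in the Leavitt path algebra. -/
def edge (r s : E → V) (e : E) : LPA K r s :=
  RingQuot.mkAlgHom K (LRel K r s) (FreeAlgebra.ι K (Sum.inr (Sum.inl e) : LGen V E))

/-- The ghost edge `e*` in the Leavitt path algebra. -/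
def ghost (r s : E → V) (e : E) : LPA K r s :=
  RingQuot.mkAlgHom K (LRel K r s) (FreeAlgebra.ι K (Sum.inr (Sum.inr e) : LGen V E))

/-- `RangedPath r s p v` : `p` is a path (possibly of length `0`) with range `v`;
a path of length `0` is a vertex. -/
def RangedPath (r s : E → V) (p : List E) (v : V) : Prop :=
  p.Chain' (pathRel r s) ∧ ∀ h : p ≠ [], r (p.getLast h) = v

/-- The monomial `α` in the Leavitt path algebra associated to a path `α` with
range `v`: the product of the edges of `α`, or the idempotent `v` if `α` has
length `0`. -/
def pathE (r s : E → V) (p : List E) (v : V) : LPA K r s :=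
  if p.isEmpty then vert K r s v else (p.map (edge K r s)).prod

/-- The monomial `α*` in the Leavitt path algebra associated to a path `α` with
range `v`: the product of the ghost edges of `α` in reverse order, or the
idempotent `v` if `α` has length `0`. -/
def pathStarE (r s : E → V) (p : List E) (v : V) : LPA K r s :=
  if p.isEmpty then vert K r s v else (p.reverse.map (ghost K r s)).prod

/-- The gap idempotent `v^H = v − ∑_{s(e) = v, r(e) ∉ H} e e*`. -/
noncomputable def gapL (r s : E → V) (H : Set V) (v : V)
    (hfin : {e : E | s e = v ∧ r e ∉ H}.Finite) : LPA K r s :=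
  vert K r s v - ∑ e ∈ hfin.toFinset, edge K r s e * ghost K r s e

/-- The generating set `{v : v ∈ H} ∪ {v^H : v ∈ S}` of the ideal `I_{(H,S)}`. -/
def idealGens (r s : E → V) (H S : Set V) (hS : S ⊆ breakingVertices r s H) :
    Set (LPA K r s) :=
  (vert K r s '' H) ∪
    {x | ∃ v : V, ∃ hv : v ∈ S, x = gapL K r s H v ((hS hv).2.1)}

end LPA

section Bar

variable (K : Type*) [Field K]

/-- The elements `Q_w` of `L_K(E)`, for `w` a vertex of `Ē_{(H,S)}`:
`Q_w = w` for `w ∈ H`; `Q_w = w^H` for `w ∈ S`; `Q_α = αα*` for `α ∈ F₁`;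
`Q_α = α r(α)^H α*` for `α ∈ F₂`. -/
noncomputable def QLP (r s : E → V) (H S : Set V)
    (hS : S ⊆ breakingVertices r s H) : BarV r s H S → LPA K r s
  | .inl (.inl v) => vert K r s v.1
  | .inl (.inr v) => gapL K r s H v.1 ((hS v.2).2.1)
  | .inr (.inl p) => (p.1.map (edge K r s)).prod * (p.1.reverse.map (ghost K r s)).prod
  | .inr (.inr p) => (p.1.map (edge K r s)).prod *
      gapL K r s H (r (p.1.getLast p.2.choose)) ((hS p.2.choose_spec.2).2.1) *
      (p.1.reverse.map (ghost K r s)).prod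

/-- The elements `T_f` of `L_K(E)`, for `f` an edge of `Ē_{(H,S)}`:
`T_f = f` for `f ∈ E¹`; `T_ā = α` for `α ∈ F₁`; `T_ā = α r(α)^H` for `α ∈ F₂`. -/
noncomputable def TLP (r s : E → V) (H S : Set V)
    (hS : S ⊆ breakingVertices r s H) : BarE r s H S → LPA K r s
  | .inl (.inl e) => edge K r s e.1
  | .inl (.inr e) => edge K r s e.1
  | .inr (.inl p) => (p.1.map (edge K r s)).prod
  | .inr (.inr p) => (p.1.map (edge K r s)).prod *
      gapL K r s H (r (p.1.getLast p.2.choose)) ((hS p.2.choose_spec.2).2.1)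

/-- The elements `T_f^*` of `L_K(E)`, for `f` an edge of `Ē_{(H,S)}`:
`T_f^* = f*` for `f ∈ E¹`; `T_ā^* = α*` for `α ∈ F₁`; `T_ā^* = r(α)^H α*` for `α ∈ F₂`. -/
noncomputable def TLPst (r s : E → V) (H S : Set V)
    (hS : S ⊆ breakingVertices r s H) : BarE r s H S → LPA K r s
  | .inl (.inl e) => ghost K r s e.1
  | .inl (.inr e) => ghost K r s e.1
  | .inr (.inl p) => (p.1.reverse.map (ghost K r s)).prod
  | .inr (.inr p) =>
      gapL K r s H (r (p.1.getLast p.2.choose)) ((hS p.2.choose_spec.2).2.1) *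
      (p.1.reverse.map (ghost K r s)).prod

section Relations

variable {K} {r s : E → V}

lemma vert_mul_vert_of_ne {v w : V} (h : v ≠ w) : vert K r s v * vert K r s w = 0 := by
  simpa [vert] using RingQuot.mkAlgHom_rel K (LRel.vertOrth (K := K) (r := r) (s := s) h)

lemma vert_mul_self (v : V) : vert K r s v * vert K r s v = vert K r s v := by
  simpa [vert] using RingQuot.mkAlgHom_rel K (LRel.vertIdem (K := K) (r := r) (s := s) v)

lemma vert_source_mul_edge (e : E) : vert K r s (s e) * edge K r s e = edge K r s e := by
  simpa [vert, edge] using RingQuot.mkAlgHom_rel K (LRel.srcMul (K := K) (r := r) (s := s) e)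

lemma edge_mul_vert_range (e : E) : edge K r s e * vert K r s (r e) = edge K r s e := by
  simpa [vert, edge] using RingQuot.mkAlgHom_rel K (LRel.mulRng (K := K) (r := r) (s := s) e)

lemma vert_range_mul_ghost (e : E) : vert K r s (r e) * ghost K r s e = ghost K r s e := by
  simpa [vert, ghost] using
    RingQuot.mkAlgHom_rel K (LRel.rngMulStar (K := K) (r := r) (s := s) e)

lemma ghost_mul_vert_source (e : E) : ghost K r s e * vert K r s (s e) = ghost K r s e := by
  simpa [vert, ghost] using
    RingQuot.mkAlgHom_rel K (LRel.starMulSrc (K := K) (r := r) (s := s) e)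

lemma ghost_mul_edge_of_ne {e f : E} (h : e ≠ f) : ghost K r s e * edge K r s f = 0 := by
  simpa [edge, ghost] using RingQuot.mkAlgHom_rel K (LRel.ck1Orth (K := K) (r := r) (s := s) h)

lemma ghost_mul_edge_self (e : E) : ghost K r s e * edge K r s e = vert K r s (r e) := by
  simpa [vert, edge, ghost] using
    RingQuot.mkAlgHom_rel K (LRel.ck1 (K := K) (r := r) (s := s) e)

lemma vert_eq_sum (v : V) (hfin : (s ⁻¹' {v}).Finite) (hne : (s ⁻¹' {v}).Nonempty) :
    vert K r s v = ∑ e ∈ hfin.toFinset, edge K r s e * ghost K r s e := by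
  simpa [vert, edge, ghost] using
    RingQuot.mkAlgHom_rel K (LRel.ck2 (K := K) (r := r) (s := s) v hfin hne)

lemma vert_mul_edge_of_ne {v : V} {e : E} (h : v ≠ s e) : vert K r s v * edge K r s e = 0 := by
  rw [← vert_source_mul_edge, ← mul_assoc, vert_mul_vert_of_ne h, zero_mul]

lemma edge_mul_vert_of_ne {v : V} {e : E} (h : r e ≠ v) : edge K r s e * vert K r s v = 0 := by
  rw [← edge_mul_vert_range, mul_assoc, vert_mul_vert_of_ne h, mul_zero]

lemma ghost_mul_vert_of_ne {v : V} {e : E} (h : s e ≠ v) : ghost K r s e * vert K r s v = 0 := by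
  rw [← ghost_mul_vert_source, mul_assoc, vert_mul_vert_of_ne h, mul_zero]

lemma edge_mul_edge_of_ne {e f : E} (h : r e ≠ s f) : edge K r s e * edge K r s f = 0 := by
  rw [← vert_source_mul_edge f, ← mul_assoc, edge_mul_vert_of_ne h, zero_mul]

/-- An induction principle for the unitalized Leavitt path algebra. -/
lemma LPA.induction {P : LPA K r s → Prop} (algebraMap : ∀ c, P (algebraMap K _ c))
    (vert : ∀ v, P (vert K r s v)) (edge : ∀ e, P (edge K r s e))
    (ghost : ∀ e, P (ghost K r s e)) (mul : ∀ x y, P x → P y → P (x * y))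
    (add : ∀ x y, P x → P y → P (x + y)) (x : LPA K r s) : P x := by
  obtain ⟨y, rfl⟩ := RingQuot.mkAlgHom_surjective K (LRel K r s) x
  induction y with
  | grade0 c => simpa using algebraMap c
  | grade1 g => rcases g with v | e | e <;> [exact vert v; exact edge e; exact ghost e]
  | mul x y hx hy => simpa using mul _ _ hx hy
  | add x y hx hy => simpa using add _ _ hx hy

end Relations

section Involution

open MulOpposite

variable {K} {r s : E → V}

/-- The images of the generators under the canonical involution. -/
def starGen (r s : E → V) : LGen V E → (LPA K r s)ᵐᵒᵖ
  | .inl v => op (vert K r s v)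
  | .inr (.inl e) => op (ghost K r s e)
  | .inr (.inr e) => op (edge K r s e)

/-- The canonical involution, which exchanges `e` and `e*`, as a homomorphism to the
opposite algebra. -/
noncomputable def starHom (r s : E → V) : LPA K r s →ₐ[K] (LPA K r s)ᵐᵒᵖ :=
  RingQuot.liftAlgHom K ⟨FreeAlgebra.lift K (starGen r s), by
    intro x y h
    induction h with
    | vertOrth h => simp [starGen, ← op_mul, vert_mul_vert_of_ne h.symm]
    | vertIdem v => simp [starGen, ← op_mul, vert_mul_self]
    | srcMul e => simp [starGen, ← op_mul, ghost_mul_vert_source]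
    | mulRng e => simp [starGen, ← op_mul, vert_range_mul_ghost]
    | rngMulStar e => simp [starGen, ← op_mul, edge_mul_vert_range]
    | starMulSrc e => simp [starGen, ← op_mul, vert_source_mul_edge]
    | ck1Orth h => simp [starGen, ← op_mul, ghost_mul_edge_of_ne h.symm]
    | ck1 e => simp [starGen, ← op_mul, ghost_mul_edge_self]
    | ck2 v hfin hne => simp [starGen, ← op_mul, vert_eq_sum v hfin hne]⟩

/-- The canonical involution of the Leavitt path algebra. -/
noncomputable def invol (x : LPA K r s) : LPA K r s := (starHom r s x).unop

@[simp] lemma invol_vert (v : V) : invol (vert K r s v) = vert K r s v := by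
  simp [invol, starHom, starGen, vert]

@[simp] lemma invol_edge (e : E) : invol (edge K r s e) = ghost K r s e := by
  simp [invol, starHom, starGen, edge]

@[simp] lemma invol_ghost (e : E) : invol (ghost K r s e) = edge K r s e := by
  simp [invol, starHom, starGen, ghost]

@[simp] lemma invol_mul (x y : LPA K r s) : invol (x * y) = invol y * invol x := by
  simp [invol]

@[simp] lemma invol_add (x y : LPA K r s) : invol (x + y) = invol x + invol y := by
  simp [invol]

@[simp] lemma invol_sub (x y : LPA K r s) : invol (x - y) = invol x - invol y := by
  simp [invol]

@[simp] lemma invol_zero : invol (0 : LPA K r s) = 0 := by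
  simp [invol]

@[simp] lemma invol_one : invol (1 : LPA K r s) = 1 := by
  simp [invol]

@[simp] lemma invol_smul (c : K) (x : LPA K r s) : invol (c • x) = c • invol x := by
  simp [invol]

@[simp] lemma invol_sum {ι : Type*} (t : Finset ι) (f : ι → LPA K r s) :
    invol (∑ i ∈ t, f i) = ∑ i ∈ t, invol (f i) := by
  simp [invol]

@[simp] lemma invol_invol (x : LPA K r s) : invol (invol x) = x := by
  induction x using LPA.induction with
  | algebraMap c => simp [Algebra.algebraMap_eq_smul_one]
  | vert v => simp
  | edge e => simp
  | ghost e => simp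
  | mul x y hx hy => simp [hx, hy]
  | add x y hx hy => simp [hx, hy]

lemma invol_prod_edge (p : List E) :
    invol (p.map (edge K r s)).prod = (p.reverse.map (ghost K r s)).prod := by
  induction p with
  | nil => simp
  | cons e p ih => simp [ih]

end Involution

section Gap

variable {K} {r s : E → V} {H : Set V} {v : V} (hfin : {e : E | s e = v ∧ r e ∉ H}.Finite)

@[simp] lemma invol_gapL : invol (gapL K r s H v hfin) = gapL K r s H v hfin := by
  simp [gapL]

lemma vert_mul_gapL : vert K r s v * gapL K r s H v hfin = gapL K r s H v hfin := by
  rw [gapL, mul_sub, vert_mul_self, Finset.mul_sum]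
  congr 1
  refine Finset.sum_congr rfl fun e he => ?_
  obtain ⟨rfl, -⟩ := hfin.mem_toFinset.1 he
  rw [← mul_assoc, vert_source_mul_edge]

lemma vert_mul_gapL_of_ne {w : V} (h : w ≠ v) :
    vert K r s w * gapL K r s H v hfin = 0 := by
  rw [← vert_mul_gapL, ← mul_assoc, vert_mul_vert_of_ne h, zero_mul]

lemma ghost_mul_gapL_of_ne {e : E} (h : s e ≠ v) :
    ghost K r s e * gapL K r s H v hfin = 0 := by
  rw [← vert_mul_gapL, ← mul_assoc, ghost_mul_vert_of_ne h, zero_mul]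

lemma ghost_mul_gapL_of_notMem {e : E} (hr : r e ∉ H) :
    ghost K r s e * gapL K r s H v hfin = 0 := by
  by_cases hs : s e = v
  · rw [gapL, mul_sub, Finset.mul_sum, Finset.sum_eq_single e]
    · subst hs
      rw [← mul_assoc, ghost_mul_edge_self, vert_range_mul_ghost, ghost_mul_vert_source, sub_self]
    · intro f _ hf
      rw [← mul_assoc, ghost_mul_edge_of_ne hf.symm, zero_mul]
    · intro h
      exact absurd (hfin.mem_toFinset.2 ⟨hs, hr⟩) h
  · exact ghost_mul_gapL_of_ne hfin hs

lemma ghost_mul_gapL_of_mem {e : E} (hs : s e = v) (hr : r e ∈ H) :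
    ghost K r s e * gapL K r s H v hfin = ghost K r s e := by
  subst hs
  rw [gapL, mul_sub, ghost_mul_vert_source, Finset.mul_sum, Finset.sum_eq_zero, sub_zero]
  intro f hf
  have hne : e ≠ f := by
    rintro rfl
    exact (hfin.mem_toFinset.1 hf).2 hr
  rw [← mul_assoc, ghost_mul_edge_of_ne hne, zero_mul]

lemma gapL_mul_edge_of_mem {e : E} (hs : s e = v) (hr : r e ∈ H) :
    gapL K r s H v hfin * edge K r s e = edge K r s e := by
  simpa using congrArg invol (ghost_mul_gapL_of_mem (K := K) hfin hs hr)

lemma gapL_mul_self :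
    gapL K r s H v hfin * gapL K r s H v hfin = gapL K r s H v hfin := by
  conv_lhs => enter [1]; rw [gapL]
  rw [sub_mul, vert_mul_gapL, Finset.sum_mul, Finset.sum_eq_zero, sub_zero]
  intro e he
  rw [mul_assoc, ghost_mul_gapL_of_notMem hfin (hfin.mem_toFinset.1 he).2, mul_zero]

end Gap

section Paths

variable {K} {r s : E → V}

lemma prod_edge_eq_zero {p : List E} (hp : ¬ p.IsChain (pathRel r s)) :
    (p.map (edge K r s)).prod = 0 := by
  induction p with
  | nil => simp at hp
  | cons e p ih =>
    cases p with
    | nil => simp at hp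
    | cons f p =>
      rw [List.isChain_cons_cons, not_and_or] at hp
      rcases hp with h | h
      · simp [← mul_assoc, edge_mul_edge_of_ne h]
      · rw [List.map_cons, List.prod_cons, ih h, mul_zero]

lemma prod_edge_mul_vert_getLast {p : List E} (h : p ≠ []) :
    (p.map (edge K r s)).prod * vert K r s (r (p.getLast h)) = (p.map (edge K r s)).prod := by
  induction p using List.reverseRecOn with
  | nil => exact absurd rfl h
  | append_singleton q e => simp [mul_assoc, edge_mul_vert_range]

lemma prod_edge_mul_gapL_of_ne {H : Set V} {v : V} (hfin : {e : E | s e = v ∧ r e ∉ H}.Finite)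
    {p : List E} (h : p ≠ []) (hv : r (p.getLast h) ≠ v) :
    (p.map (edge K r s)).prod * gapL K r s H v hfin = 0 := by
  rw [← prod_edge_mul_vert_getLast h, mul_assoc, vert_mul_gapL_of_ne hfin hv, mul_zero]

end Paths

/-- The left half of the spanning monomials of `I_{(H,S)}`: products `e₁ ⋯ eₙ x`, where `x` is
one of the generators of the ideal. -/
inductive LeftMonomial (r s : E → V) (H S : Set V) (hS : S ⊆ breakingVertices r s H) :
    LPA K r s → Prop
  | vert {v : V} (hv : v ∈ H) : LeftMonomial r s H S hS (vert K r s v)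
  | gap {v : V} (hv : v ∈ S) : LeftMonomial r s H S hS (gapL K r s H v (hS hv).2.1)
  | edge (e : E) {m : LPA K r s} (hm : LeftMonomial r s H S hS m) :
      LeftMonomial r s H S hS (edge K r s e * m)

/-- The generators of the subalgebra in `adjoin_QT_eq_ideal`. -/
def QTGens (r s : E → V) (H S : Set V) (hS : S ⊆ breakingVertices r s H) : Set (LPA K r s) :=
  Set.range (QLP K r s H S hS) ∪ Set.range (TLP K r s H S hS) ∪ Set.range (TLPst K r s H S hS)

section Monomials

variable {K} {r s : E → V} {H S : Set V} {hS : S ⊆ breakingVertices r s H}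

lemma LeftMonomial.prod_edge_mul (p : List E) {m : LPA K r s}
    (hm : LeftMonomial K r s H S hS m) :
    LeftMonomial K r s H S hS ((p.map (GraphIdeals.edge K r s)).prod * m) := by
  induction p with
  | nil => simpa using hm
  | cons e p ih => simpa [mul_assoc] using ih.edge e

lemma LeftMonomial.vert_mul (w : V) {m : LPA K r s} (hm : LeftMonomial K r s H S hS m) :
    GraphIdeals.vert K r s w * m = m ∨ GraphIdeals.vert K r s w * m = 0 := by
  cases hm with
  | @vert v hv =>
    by_cases h : w = v
    · exact .inl (h ▸ vert_mul_self w)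
    · exact .inr (vert_mul_vert_of_ne h)
  | @gap v hv =>
    by_cases h : w = v
    · subst h
      exact .inl (vert_mul_gapL _)
    · exact .inr (vert_mul_gapL_of_ne _ h)
  | @edge e m hm =>
    by_cases h : w = s e
    · subst h
      exact .inl (by rw [← mul_assoc, vert_source_mul_edge])
    · exact .inr (by rw [← mul_assoc, vert_mul_edge_of_ne h, zero_mul])

lemma LeftMonomial.exists_mul_eq {m : LPA K r s} (hm : LeftMonomial K r s H S hS m) :
    ∃ x, LeftMonomial K r s H S hS x ∧ invol x = x ∧ m * x = m := by
  induction hm with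
  | vert hv => exact ⟨_, .vert hv, invol_vert _, vert_mul_self _⟩
  | gap hv => exact ⟨_, .gap hv, invol_gapL _, gapL_mul_self _⟩
  | edge e hm ih =>
    obtain ⟨x, hx, hi, h⟩ := ih
    exact ⟨x, hx, hi, by rw [mul_assoc, h]⟩

lemma LeftMonomial.mem_span {m : LPA K r s} (hm : LeftMonomial K r s H S hS m) :
    m ∈ TwoSidedIdeal.span (idealGens K r s H S hS) := by
  induction hm with
  | vert hv => exact TwoSidedIdeal.subset_span (.inl ⟨_, hv, rfl⟩)
  | gap hv => exact TwoSidedIdeal.subset_span (.inr ⟨_, hv, rfl⟩)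
  | edge e hm ih => exact TwoSidedIdeal.mul_mem_left _ _ _ ih

lemma leftMonomial_TLP (hH : Hereditary r s H) (f : BarE r s H S) :
    LeftMonomial K r s H S hS (TLP K r s H S hS f) := by
  rcases f with (e | e) | (p | p)
  · simpa [TLP, edge_mul_vert_range] using
      (LeftMonomial.vert (K := K) (hS := hS) (hH e.1 e.2)).edge e.1
  · simpa [TLP, edge_mul_vert_range] using
      (LeftMonomial.vert (K := K) (hS := hS) e.2.2).edge e.1
  · obtain ⟨h, -, hr, -⟩ := p.2
    simpa [TLP, prod_edge_mul_vert_getLast] using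
      (LeftMonomial.vert (K := K) (hS := hS) hr).prod_edge_mul p.1
  · exact (LeftMonomial.gap p.2.choose_spec.2).prod_edge_mul p.1

lemma TLPst_eq_invol (f : BarE r s H S) :
    TLPst K r s H S hS f = invol (TLP K r s H S hS f) := by
  rcases f with (e | e) | (p | p) <;> simp [TLP, TLPst, invol_prod_edge]

lemma invol_QLP (w : BarV r s H S) :
    invol (QLP K r s H S hS w) = QLP K r s H S hS w := by
  rcases w with (v | v) | (p | p) <;> simp only [QLP, ← invol_prod_edge, invol_mul, invol_invol,
    invol_vert, invol_gapL, mul_assoc]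

lemma exists_eq_mul_invol (hH : Hereditary r s H) {x : LPA K r s}
    (hx : x ∈ QTGens K r s H S hS) :
    ∃ m n, LeftMonomial K r s H S hS m ∧ LeftMonomial K r s H S hS n ∧ x = m * invol n := by
  have key : ∀ {m : LPA K r s}, LeftMonomial K r s H S hS m →
      ∃ m' n, LeftMonomial K r s H S hS m' ∧ LeftMonomial K r s H S hS n ∧
        m = m' * invol n := by
    intro m hm
    obtain ⟨y, hy, hi, h⟩ := hm.exists_mul_eq
    exact ⟨m, y, hm, hy, by rw [hi, h]⟩
  rcases hx with (⟨w, rfl⟩ | ⟨f, rfl⟩) | ⟨f, rfl⟩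
  · rcases w with (v | v) | (p | p)
    · exact key (.vert v.2)
    · exact key (.gap v.2)
    · have h := leftMonomial_TLP (K := K) (hS := hS) hH (.inr (.inl p))
      exact ⟨_, _, h, h, by simp [QLP, TLP, invol_prod_edge]⟩
    · refine ⟨_, _, leftMonomial_TLP (K := K) (hS := hS) hH (.inr (.inr p)),
        leftMonomial_TLP (K := K) (hS := hS) hH (.inr (.inr p)), ?_⟩
      simp only [QLP, TLP, invol_mul, invol_gapL, invol_prod_edge]
      rw [← mul_assoc, mul_assoc _ (gapL _ _ _ _ _ _) (gapL _ _ _ _ _ _), gapL_mul_self]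
  · exact key (leftMonomial_TLP hH f)
  · rw [TLPst_eq_invol]
    obtain ⟨m, n, hm, hn, h⟩ := key (leftMonomial_TLP (K := K) (hS := hS) hH f)
    exact ⟨n, m, hn, hm, by rw [h, invol_mul, invol_invol]⟩

lemma QLP_mem_adjoin (w : BarV r s H S) :
    QLP K r s H S hS w ∈ NonUnitalAlgebra.adjoin K (QTGens K r s H S hS) :=
  NonUnitalAlgebra.subset_adjoin K (.inl (.inl ⟨w, rfl⟩))

lemma TLP_mem_adjoin (f : BarE r s H S) :
    TLP K r s H S hS f ∈ NonUnitalAlgebra.adjoin K (QTGens K r s H S hS) :=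
  NonUnitalAlgebra.subset_adjoin K (.inl (.inr ⟨f, rfl⟩))

lemma TLPst_mem_adjoin (f : BarE r s H S) :
    TLPst K r s H S hS f ∈ NonUnitalAlgebra.adjoin K (QTGens K r s H S hS) :=
  NonUnitalAlgebra.subset_adjoin K (.inr ⟨f, rfl⟩)

lemma invol_mem_adjoin {x : LPA K r s}
    (hx : x ∈ NonUnitalAlgebra.adjoin K (QTGens K r s H S hS)) :
    invol x ∈ NonUnitalAlgebra.adjoin K (QTGens K r s H S hS) := by
  induction hx using NonUnitalAlgebra.adjoin_induction with
  | mem x hx =>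
    rcases hx with (⟨w, rfl⟩ | ⟨f, rfl⟩) | ⟨f, rfl⟩
    · rw [invol_QLP]
      exact QLP_mem_adjoin w
    · rw [← TLPst_eq_invol]
      exact TLPst_mem_adjoin f
    · rw [TLPst_eq_invol, invol_invol]
      exact TLP_mem_adjoin f
  | add x y _ _ hx hy => simpa using add_mem hx hy
  | zero => simp
  | mul x y _ _ hx hy => simpa using mul_mem hy hx
  | smul c x _ hx => simpa using SMulMemClass.smul_mem c hx

lemma prod_edge_mul_gapL_mem_adjoin (p : List E) {v : V} (hv : v ∈ S) :
    (p.map (edge K r s)).prod * gapL K r s H v (hS hv).2.1 ∈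
      NonUnitalAlgebra.adjoin K (QTGens K r s H S hS) := by
  by_cases hp : p = []
  · subst hp
    simpa [QLP] using QLP_mem_adjoin (K := K) (hS := hS) (.inl (.inr ⟨v, hv⟩))
  by_cases hr : r (p.getLast hp) = v
  · by_cases hc : p.IsChain (pathRel r s)
    · subst hr
      exact TLP_mem_adjoin (K := K) (hS := hS) (.inr (.inr ⟨p, hp, hc, hv⟩))
    · rw [prod_edge_eq_zero hc, zero_mul]
      exact zero_mem _
  · rw [prod_edge_mul_gapL_of_ne _ hp hr]
    exact zero_mem _

lemma prod_edge_mul_vert_mem_adjoin (p : List E) {v : V} (hv : v ∈ H) :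
    (p.map (edge K r s)).prod * vert K r s v ∈
      NonUnitalAlgebra.adjoin K (QTGens K r s H S hS) := by
  induction p using List.reverseRecOn generalizing v with
  | nil => simpa [QLP] using QLP_mem_adjoin (K := K) (hS := hS) (.inl (.inl ⟨v, hv⟩))
  | append_singleton q e ih =>
    by_cases hr : r e = v
    · subst hr
      rw [List.map_append, List.prod_append, List.map_singleton, List.prod_singleton, mul_assoc,
        edge_mul_vert_range]
      by_cases hsH : s e ∈ H
      · rw [← vert_source_mul_edge, ← mul_assoc]
        exact mul_mem (ih hsH) (TLP_mem_adjoin (.inl (.inl ⟨e, hsH⟩)))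
      by_cases hsS : s e ∈ S
      · rw [← gapL_mul_edge_of_mem (hS hsS).2.1 rfl hv, ← mul_assoc]
        exact mul_mem (prod_edge_mul_gapL_mem_adjoin q hsS)
          (TLP_mem_adjoin (.inl (.inr ⟨e, hsS, hv⟩)))
      by_cases hc : (q ++ [e]).IsChain (pathRel r s)
      · have hF : q ++ [e] ∈ F1 r s H S := ⟨by simp, hc, by simpa using hv, by simp [hsH, hsS]⟩
        simpa [TLP] using TLP_mem_adjoin (K := K) (hS := hS) (.inr (.inl ⟨q ++ [e], hF⟩))
      · have h := prod_edge_eq_zero (K := K) hc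
        rw [List.map_append, List.prod_append, List.map_singleton, List.prod_singleton] at h
        rw [h]
        exact zero_mem _
    · simp [mul_assoc, edge_mul_vert_of_ne hr]

lemma LeftMonomial.mem_adjoin {m : LPA K r s} (hm : LeftMonomial K r s H S hS m) :
    m ∈ NonUnitalAlgebra.adjoin K (QTGens K r s H S hS) := by
  suffices h : ∀ p : List E, (p.map (GraphIdeals.edge K r s)).prod * m ∈
      NonUnitalAlgebra.adjoin K (QTGens K r s H S hS) by simpa using h []
  induction hm with
  | vert hv => exact fun p => prod_edge_mul_vert_mem_adjoin p hv
  | gap hv => exact fun p => prod_edge_mul_gapL_mem_adjoin p hv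
  | edge e hm ih => exact fun p => by simpa [mul_assoc] using ih (p ++ [e])

lemma LeftMonomial.vert_mul_mem_adjoin (w : V) {m : LPA K r s}
    (hm : LeftMonomial K r s H S hS m) :
    GraphIdeals.vert K r s w * m ∈ NonUnitalAlgebra.adjoin K (QTGens K r s H S hS) := by
  rcases hm.vert_mul w with h | h <;> rw [h]
  exacts [hm.mem_adjoin, zero_mem _]

lemma LeftMonomial.ghost_mul_mem_adjoin (e : E) {m : LPA K r s}
    (hm : LeftMonomial K r s H S hS m) :
    ghost K r s e * m ∈ NonUnitalAlgebra.adjoin K (QTGens K r s H S hS) := by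
  cases hm with
  | @vert v hv =>
    by_cases h : s e = v
    · subst h
      rw [ghost_mul_vert_source]
      exact TLPst_mem_adjoin (.inl (.inl ⟨e, hv⟩))
    · rw [ghost_mul_vert_of_ne h]
      exact zero_mem _
  | @gap v hv =>
    by_cases hs : s e = v
    · by_cases hr : r e ∈ H
      · rw [ghost_mul_gapL_of_mem _ hs hr]
        exact TLPst_mem_adjoin (.inl (.inr ⟨e, hs ▸ hv, hr⟩))
      · rw [ghost_mul_gapL_of_notMem _ hr]
        exact zero_mem _
    · rw [ghost_mul_gapL_of_ne _ hs]
      exact zero_mem _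
  | @edge f m hm =>
    rw [← mul_assoc]
    by_cases h : e = f
    · subst h
      rw [ghost_mul_edge_self]
      exact hm.vert_mul_mem_adjoin _
    · rw [ghost_mul_edge_of_ne h, zero_mul]
      exact zero_mem _

/-- To show that the subalgebra absorbs `g` on the left, it suffices to multiply monomials. -/
lemma mul_mem_adjoin_of_leftMonomial (hH : Hereditary r s H) {g : LPA K r s}
    (hg : ∀ m, LeftMonomial K r s H S hS m →
      g * m ∈ NonUnitalAlgebra.adjoin K (QTGens K r s H S hS)) {a : LPA K r s}
    (ha : a ∈ NonUnitalAlgebra.adjoin K (QTGens K r s H S hS)) :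
    g * a ∈ NonUnitalAlgebra.adjoin K (QTGens K r s H S hS) := by
  induction ha using NonUnitalAlgebra.adjoin_induction with
  | mem x hx =>
    obtain ⟨m, n, hm, hn, rfl⟩ := exists_eq_mul_invol hH hx
    rw [← mul_assoc]
    exact mul_mem (hg m hm) (invol_mem_adjoin hn.mem_adjoin)
  | add x y _ _ hx hy => simpa [mul_add] using add_mem hx hy
  | zero => simp
  | mul x y _ hy hx _ => simpa [mul_assoc] using mul_mem hx hy
  | smul c x _ hx => simpa using SMulMemClass.smul_mem c hx

lemma mul_mem_adjoin_left (hH : Hereditary r s H) (g : LPA K r s) :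
    ∀ a ∈ NonUnitalAlgebra.adjoin K (QTGens K r s H S hS),
      g * a ∈ NonUnitalAlgebra.adjoin K (QTGens K r s H S hS) := by
  induction g using LPA.induction with
  | algebraMap c =>
    intro a ha
    rw [← Algebra.smul_def]
    exact SMulMemClass.smul_mem c ha
  | vert v =>
    exact fun a => mul_mem_adjoin_of_leftMonomial hH fun m hm => hm.vert_mul_mem_adjoin v
  | edge e =>
    exact fun a => mul_mem_adjoin_of_leftMonomial hH fun m hm => (hm.edge e).mem_adjoin
  | ghost e =>
    exact fun a => mul_mem_adjoin_of_leftMonomial hH fun m hm => hm.ghost_mul_mem_adjoin e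
  | mul x y hx hy =>
    intro a ha
    rw [mul_assoc]
    exact hx _ (hy a ha)
  | add x y hx hy =>
    intro a ha
    rw [add_mul]
    exact add_mem (hx a ha) (hy a ha)

lemma mul_mem_adjoin_right (hH : Hereditary r s H) (g : LPA K r s) {a : LPA K r s}
    (ha : a ∈ NonUnitalAlgebra.adjoin K (QTGens K r s H S hS)) :
    a * g ∈ NonUnitalAlgebra.adjoin K (QTGens K r s H S hS) := by
  simpa using invol_mem_adjoin (mul_mem_adjoin_left hH (invol g) _ (invol_mem_adjoin ha))

end Monomials

/-- For `H` saturated hereditary and `S ⊆ B_H`, the (non-unital)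
`K`-subalgebra of `L_K(E)` generated by
`{Q_w} ∪ {T_f, T_f^*}` equals the two-sided ideal `I_{(H,S)}` generated by
`{v : v ∈ H} ∪ {v^H : v ∈ S}`. -/
theorem adjoin_QT_eq_ideal
    (r s : E → V) (H S : Set V) (hH : Hereditary r s H) (hSat : Saturated r s H)
    (hS : S ⊆ breakingVertices r s H) :
    (NonUnitalAlgebra.adjoin K
        (Set.range (QLP K r s H S hS) ∪ Set.range (TLP K r s H S hS) ∪
          Set.range (TLPst K r s H S hS)) : Set (LPA K r s)) =
      (TwoSidedIdeal.span (idealGens K r s H S hS) : Set (LPA K r s)) := by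
  change (NonUnitalAlgebra.adjoin K (QTGens K r s H S hS) : Set (LPA K r s)) = _
  refine Set.Subset.antisymm (fun x hx => ?_) fun x hx => ?_
  · change x ∈ TwoSidedIdeal.span (idealGens K r s H S hS)
    induction hx using NonUnitalAlgebra.adjoin_induction with
    | mem x hx =>
      obtain ⟨m, n, hm, -, rfl⟩ := exists_eq_mul_invol hH hx
      exact TwoSidedIdeal.mul_mem_right _ _ _ hm.mem_span
    | add x y _ _ hx hy => exact add_mem hx hy
    | zero => exact zero_mem _
    | mul x y _ _ hx _ => exact TwoSidedIdeal.mul_mem_right _ _ _ hx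
    | smul c x _ hx =>
      rw [Algebra.smul_def]
      exact TwoSidedIdeal.mul_mem_left _ _ _ hx
  · let J : TwoSidedIdeal (LPA K r s) := TwoSidedIdeal.mk'
      (NonUnitalAlgebra.adjoin K (QTGens K r s H S hS)) (zero_mem _) add_mem neg_mem
      (mul_mem_adjoin_left hH _ _) (mul_mem_adjoin_right hH _)
    have hJ : ∀ y, y ∈ J ↔ y ∈ NonUnitalAlgebra.adjoin K (QTGens K r s H S hS) := fun y =>
      TwoSidedIdeal.mem_mk' ..
    refine (hJ x).1 (TwoSidedIdeal.mem_span_iff.1 hx J fun y hy => (hJ y).2 ?_)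
    rcases hy with ⟨v, hv, rfl⟩ | ⟨v, hv, rfl⟩
    exacts [(LeftMonomial.vert hv).mem_adjoin, (LeftMonomial.gap hv).mem_adjoin]

end Bar

end GraphIdeals
end
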